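/- Let 𝔤 be a finite-dimensional Lie algebra over the field ℝ ∩ ℚ̄ of real algebraic numbers. Then the real Lie algebra 𝔤 ⊗_{ℝ∩ℚ̄} ℝ (with Lie bracket extended ℝ-bilinearly) is indecomposable if and only if 𝔤 is indecomposable. -/

import Mathlib

open scoped TensorProduct

/-- A Lie algebra is indecomposable if it is non-trivial and cannot be written as the
direct sum of two non-trivial ideals. -/
def IsIndecomposableLieAlgebra (K L : Type*) [CommRing K] [LieRing L] [LieAlgebra K L] :
    Prop :=
  Nontrivial L ∧ ∀ I J : LieIdeal K L, I ⊓ J = ⊥ → I ⊔ J = ⊤ → I = ⊥ ∨ J = ⊥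

/-- `f` commutes with all the adjoint maps. -/
def CentroidLike (K L : Type*) [CommRing K] [LieRing L] [LieAlgebra K L]
    (f : Module.End K L) : Prop := ∀ x y : L, f ⁅x, y⁆ = ⁅x, f y⁆

/-- The endomorphisms commuting with the adjoint maps form a subalgebra. -/
def centroidSub (K L : Type*) [CommRing K] [LieRing L] [LieAlgebra K L] :
    Subalgebra K (Module.End K L) where
  carrier := {f | CentroidLike K L f}
  mul_mem' := by
    intro a b ha hb x y
    simp only [Module.End.mul_apply]
    rw [hb, ha]
  add_mem' := by
    intro a b ha hb x y
    simp only [LinearMap.add_apply, lie_add]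
    rw [hb, ha]
  algebraMap_mem' := by
    intro r x y
    simp [Module.algebraMap_end_apply]

theorem indec_of_compl {K L : Type*} [CommRing K] [LieRing L] [LieAlgebra K L]
    (h : IsIndecomposableLieAlgebra K L) (f : Module.End K L) (hf : CentroidLike K L f)
    (hc : IsCompl (LinearMap.ker f) (LinearMap.range f)) :
    LinearMap.ker f = ⊥ ∨ LinearMap.range f = ⊥ := by
  let I : LieIdeal K L :=
    { LinearMap.ker f with
      lie_mem := by
        intro x m hm
        have hm' : f m = 0 := hm
        change f ⁅x, m⁆ = 0
        rw [hf, hm', lie_zero] }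
  let J : LieIdeal K L :=
    { LinearMap.range f with
      lie_mem := by
        rintro x m ⟨y, rfl⟩
        exact ⟨⁅x, y⁆, hf x y⟩ }
  have hI : LieSubmodule.toSubmodule I = LinearMap.ker f := rfl
  have hJ : LieSubmodule.toSubmodule J = LinearMap.range f := rfl
  have := h.2 I J
    (by
      rw [← LieSubmodule.toSubmodule_inj, LieSubmodule.inf_toSubmodule, hI, hJ]
      simpa using hc.inf_eq_bot)
    (by
      rw [← LieSubmodule.toSubmodule_inj, LieSubmodule.sup_toSubmodule, hI, hJ]
      simpa using hc.sup_eq_top)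
  rw [← LieSubmodule.toSubmodule_inj, ← LieSubmodule.toSubmodule_inj, hI, hJ] at this
  simpa using this

theorem exists_centroid_idem {K L : Type*} [CommRing K] [LieRing L] [LieAlgebra K L]
    (I J : LieIdeal K L) (h1 : I ⊓ J = ⊥) (h2 : I ⊔ J = ⊤) :
    ∃ e : Module.End K L, CentroidLike K L e ∧ IsIdempotentElem e ∧
      (e = 0 → I = ⊥) ∧ (e = 1 → J = ⊥) := by
  have hc : IsCompl (I : Submodule K L) (J : Submodule K L) := by
    rw [← LieSubmodule.toSubmodule_inj, LieSubmodule.inf_toSubmodule] at h1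
    rw [← LieSubmodule.toSubmodule_inj, LieSubmodule.sup_toSubmodule] at h2
    exact IsCompl.of_eq (by simpa using h1) (by simpa using h2)
  have eI : ∀ x ∈ I, (I : Submodule K L).projection J hc x = x := by
    intro x hx
    rw [Submodule.projection_apply, Submodule.projectionOnto_apply_of_mem_left hc hx]
  have eJ : ∀ x ∈ J, (I : Submodule K L).projection J hc x = 0 := by
    intro x hx
    rw [Submodule.projection_apply, Submodule.projectionOnto_apply_of_mem_right hc hx]
    rfl
  refine ⟨(I : Submodule K L).projection J hc, ?_,
    Submodule.isIdempotentElem_projection hc, ?_, ?_⟩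
  · intro x y
    have hy : y ∈ (I : Submodule K L) ⊔ (J : Submodule K L) := by
      rw [hc.sup_eq_top]; trivial
    obtain ⟨u, hu, v, hv, rfl⟩ := Submodule.mem_sup.1 hy
    rw [lie_add, map_add, map_add, eI u hu, eJ v hv, eI _ (I.lie_mem hu), eJ _ (J.lie_mem hv),
      add_zero, add_zero]
  · intro h0
    rw [LieSubmodule.eq_bot_iff]
    intro x hx
    rw [← eI x hx, h0]; rfl
  · intro h0
    rw [LieSubmodule.eq_bot_iff]
    intro x hx
    rw [← eJ x hx, h0]; rfl

theorem indec_idem {K L : Type*} [CommRing K] [LieRing L] [LieAlgebra K L]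
    (h : IsIndecomposableLieAlgebra K L) (e : Module.End K L) (hf : CentroidLike K L e)
    (he : IsIdempotentElem e) : e = 0 ∨ e = 1 := by
  rcases indec_of_compl h e hf (LinearMap.IsIdempotentElem.isCompl he).symm with h1 | h1
  · right
    ext x
    apply LinearMap.ker_eq_bot.1 h1
    exact congrArg (fun g : Module.End K L => g x) he
  · left
    exact LinearMap.range_eq_bot.1 h1

theorem centroid_baseChange {K L : Type*} [Field K] [Algebra K ℝ] [LieRing L] [LieAlgebra K L]
    (f : Module.End K L) (hf : CentroidLike K L f) :
    CentroidLike ℝ (ℝ ⊗[K] L) (f.baseChange ℝ) := by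
  intro x y
  induction x using TensorProduct.induction_on with
  | zero => simp
  | add a b ha hb => simp only [add_lie, map_add, ha, hb]
  | tmul r x =>
    induction y using TensorProduct.induction_on with
    | zero => simp
    | add a b ha hb => simp only [lie_add, map_add, ha, hb]
    | tmul s y =>
      simp only [LieAlgebra.ExtendScalars.bracket_tmul, LinearMap.baseChange_tmul, hf x y]

theorem baseChange_inj {K L : Type*} [Field K] [Algebra K ℝ] [AddCommGroup L] [Module K L]
    (f : Module.End K L) (hf : f.baseChange ℝ = 0) : f = 0 := by
  ext x
  apply Module.FaithfullyFlat.tensorProduct_mk_injective (A := K) (B := ℝ) L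
  have := congrArg (fun g : Module.End ℝ (ℝ ⊗[K] L) => g (1 ⊗ₜ x)) hf
  simpa using this

theorem exists_quad (K : Type*) [Field K] [Algebra K ℝ]
    (hK : Set.range (algebraMap K ℝ) = {x : ℝ | IsAlgebraic ℚ x})
    (p : Polynomial K) (hp : Irreducible p) :
    ∃ c d : K, 0 ≤ algebraMap K ℝ d ∧
      p ∣ (Polynomial.X - Polynomial.C c) ^ 2 + Polynomial.C d := by
  have : CharZero K := (algebraMap K ℝ).charZero
  have hKalg : Algebra.IsAlgebraic ℚ K := by
    constructor
    intro x
    have h : algebraMap K ℝ x ∈ {x : ℝ | IsAlgebraic ℚ x} := hK ▸ Set.mem_range_self x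
    exact (isAlgebraic_algebraMap_iff (algebraMap K ℝ).injective).1 h
  obtain ⟨z, hz⟩ := IsAlgClosed.exists_aeval_eq_zero ℂ p hp.degree_pos.ne'
  have hzK : IsAlgebraic K z := ⟨p, hp.ne_zero, hz⟩
  have hzQ : IsAlgebraic ℚ z := hzK.restrictScalars ℚ
  have hcQ : IsAlgebraic ℚ ((starRingEnd ℂ) z) :=
    hzQ.algHom ((starRingEnd ℂ).toRatAlgHom)
  have key : ∀ r : ℝ, IsAlgebraic ℚ (r : ℂ) → ∃ k : K, algebraMap K ℝ k = r := by
    intro r hr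
    have : r ∈ Set.range (algebraMap K ℝ) := by
      rw [hK]
      exact (isAlgebraic_algebraMap_iff (R := ℚ) (S := ℝ) (A := ℂ)
        (algebraMap ℝ ℂ).injective).1 hr
    exact this
  have hre : IsAlgebraic ℚ (z.re : ℂ) := by
    have h1 : (z.re : ℂ) = (z + (starRingEnd ℂ) z) * algebraMap ℚ ℂ (1/2) := by
      rw [Complex.add_conj]; simp; ring
    rw [h1]
    exact (hzQ.add hcQ).mul (isAlgebraic_algebraMap _)
  have him : IsAlgebraic ℚ ((z.im ^ 2 : ℝ) : ℂ) := by
    have h1 : ((z.im ^ 2 : ℝ) : ℂ) = z * (starRingEnd ℂ) z - z.re * z.re := by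
      rw [Complex.mul_conj, Complex.normSq_apply]; push_cast; ring
    rw [h1]
    exact (hzQ.mul hcQ).sub (hre.mul hre)
  obtain ⟨c, hc⟩ := key _ hre
  obtain ⟨d, hd⟩ := key _ him
  refine ⟨c, d, by rw [hd]; positivity, ?_⟩
  have e1 : algebraMap K ℂ c = (z.re : ℂ) := by
    rw [IsScalarTower.algebraMap_apply K ℝ ℂ, hc]; rfl
  have e2 : algebraMap K ℂ d = ((z.im ^ 2 : ℝ) : ℂ) := by
    rw [IsScalarTower.algebraMap_apply K ℝ ℂ, hd]; rfl
  have hq : Polynomial.aeval z ((Polynomial.X - Polynomial.C c) ^ 2 + Polynomial.C d) = 0 := by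
    simp only [map_add, map_pow, map_sub, Polynomial.aeval_X, Polynomial.aeval_C, e1, e2]
    have : z - z.re = z.im * Complex.I := by
      linear_combination -(Complex.re_add_im z)
    rw [this, mul_pow, Complex.I_sq]; push_cast; ring
  have hass : Associated (minpoly K z) p :=
    (minpoly.irreducible hzK.isIntegral).associated_of_dvd hp (minpoly.dvd K z hz)
  exact hass.dvd_iff_dvd_left.1 (minpoly.dvd K z hq)

theorem trace_ineq (K : Type*) [Field K] [Algebra K ℝ]
    (hK : Set.range (algebraMap K ℝ) = {x : ℝ | IsAlgebraic ℚ x})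
    (𝔤 : Type*) [LieRing 𝔤] [LieAlgebra K 𝔤] [Module.Finite K 𝔤]
    (h : IsIndecomposableLieAlgebra K 𝔤) (a : Module.End K 𝔤) (ha : CentroidLike K 𝔤 a) :
    (Module.finrank K 𝔤 : ℝ) * algebraMap K ℝ (LinearMap.trace K 𝔤 (a * a)) ≤
      (algebraMap K ℝ (LinearMap.trace K 𝔤 a)) ^ 2 := by
  have : Nontrivial 𝔤 := h.1
  have hint : IsIntegral K a := Algebra.IsIntegral.isIntegral a
  obtain ⟨p, hp, r, hr⟩ := WfDvdMonoid.exists_irreducible_factor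
    (minpoly.not_isUnit K a) (minpoly.ne_zero hint)
  obtain ⟨c, d, hd, s, hs⟩ := exists_quad K hK p hp
  have hpoly : ∀ q : Polynomial K, CentroidLike K 𝔤 (Polynomial.aeval a q) := fun q =>
    (Polynomial.aeval_mem_adjoin_singleton K a : _ ∈ Algebra.adjoin K {a}) |>
      (Algebra.adjoin_le (S := centroidSub K 𝔤) (Set.singleton_subset_iff.2 ha) ·)
  have hnil : IsNilpotent (Polynomial.aeval a p) := by
    obtain ⟨n, hn⟩ := ((Polynomial.aeval a p).eventually_isCompl_ker_pow_range_pow.and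
      (Filter.eventually_ge_atTop 1)).exists
    have hcn : CentroidLike K 𝔤 ((Polynomial.aeval a p) ^ n) := by
      rw [← map_pow]; exact hpoly _
    rcases indec_of_compl h _ hcn hn.1 with h1 | h1
    · exfalso
      have hinj : Function.Injective (Polynomial.aeval a p) := by
        have h2 := LinearMap.ker_eq_bot.1 h1
        obtain ⟨m, rfl⟩ : ∃ m, n = m + 1 := ⟨n - 1, by omega⟩
        rw [pow_succ] at h2
        exact Function.Injective.of_comp (f := ⇑((Polynomial.aeval a p) ^ m)) h2
      have h0 : Polynomial.aeval a p * Polynomial.aeval a r = 0 := by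
        rw [← map_mul, ← hr, minpoly.aeval]
      have hr0 : Polynomial.aeval a r = 0 := by
        ext x
        apply hinj
        have := congrArg (fun g : Module.End K 𝔤 => g x) h0
        simpa using this
      have hrne : r ≠ 0 := by
        rintro rfl
        exact minpoly.ne_zero hint (by rw [hr, mul_zero])
      have h3 := minpoly.dvd K a hr0
      have h4 : (minpoly K a).natDegree ≤ r.natDegree := Polynomial.natDegree_le_of_dvd h3 hrne
      rw [hr, Polynomial.natDegree_mul hp.ne_zero hrne] at h4
      have := hp.natDegree_pos
      omega
    · exact ⟨n, LinearMap.range_eq_bot.1 h1⟩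
  have hnil2 : IsNilpotent ((a - algebraMap K _ c) ^ 2 + algebraMap K (Module.End K 𝔤) d) := by
    have h5 := congrArg (Polynomial.aeval a) hs
    simp only [map_add, map_pow, map_sub, Polynomial.aeval_X, Polynomial.aeval_C, map_mul] at h5
    rw [h5]
    exact Commute.isNilpotent_mul_right
      (by rw [Commute, SemiconjBy, ← map_mul, ← map_mul, mul_comm]) hnil
  have htr := (LinearMap.isNilpotent_trace_of_isNilpotent hnil2).eq_zero
  have hexp : (a - algebraMap K _ c) ^ 2 + algebraMap K (Module.End K 𝔤) d =
      a * a - (2 * c) • a + (c ^ 2 + d) • (1 : Module.End K 𝔤) := by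
    ext x
    simp [pow_two, Module.algebraMap_end_apply, add_smul, mul_smul, two_smul, smul_sub]
    abel
  rw [hexp] at htr
  simp only [map_add, map_sub, map_smul, LinearMap.trace_one, smul_eq_mul] at htr
  have htr' := congrArg (algebraMap K ℝ) htr
  simp only [map_add, map_sub, map_mul, map_pow, map_ofNat, map_natCast, map_zero] at htr'
  set n : ℝ := (Module.finrank K 𝔤 : ℝ)
  have hn : 0 ≤ n := Nat.cast_nonneg _
  set t := algebraMap K ℝ (LinearMap.trace K 𝔤 a)
  set t2 := algebraMap K ℝ (LinearMap.trace K 𝔤 (a * a))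
  set c' := algebraMap K ℝ c
  set d' := algebraMap K ℝ d
  have : n * t2 = 2 * c' * n * t - n ^ 2 * c' ^ 2 - n ^ 2 * d' := by
    linear_combination n * htr'
  have h6 : 0 ≤ n ^ 2 * d' := by positivity
  nlinarith [sq_nonneg (t - n * c')]

theorem exists_expansion (K : Type*) [Field K] [Algebra K ℝ]
    (𝔤 : Type*) [LieRing 𝔤] [LieAlgebra K 𝔤] [Module.Finite K 𝔤]
    (e : Module.End ℝ (ℝ ⊗[K] 𝔤)) (he : CentroidLike ℝ (ℝ ⊗[K] 𝔤) e) :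
    ∃ (m : ℕ) (β : Fin m → ℝ) (E : Fin m → Module.End K 𝔤),
      (∀ i, CentroidLike K 𝔤 (E i)) ∧ e = ∑ i, β i • (E i).baseChange ℝ := by
  classical
  let B := Module.Basis.ofVectorSpace K ℝ
  let φ := TensorProduct.equivFinsuppOfBasisLeft (N := 𝔤) B
  let F : Module.Basis.ofVectorSpaceIndex K ℝ → Module.End K 𝔤 := fun j =>
    Finsupp.lapply j ∘ₗ φ.toLinearMap ∘ₗ e.restrictScalars K ∘ₗ TensorProduct.mk K ℝ 𝔤 1
  have hF : ∀ j x, F j x = φ (e (1 ⊗ₜ x)) j := fun j x => rfl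
  have hφ : ∀ (j) (x : 𝔤) (z : ℝ ⊗[K] 𝔤), φ ⁅(1 : ℝ) ⊗ₜ[K] x, z⁆ j = ⁅x, φ z j⁆ := by
    intro j x z
    induction z using TensorProduct.induction_on with
    | zero => simp
    | add a b ha hb => simp only [lie_add, map_add, Finsupp.add_apply, ha, hb]
    | tmul s y =>
      rw [LieAlgebra.ExtendScalars.bracket_tmul]
      simp only [φ, TensorProduct.equivFinsuppOfBasisLeft_apply_tmul_apply, one_mul, lie_smul]
  have hFc : ∀ j, CentroidLike K 𝔤 (F j) := by
    intro j x y
    rw [hF, hF, ← hφ, ← he, LieAlgebra.ExtendScalars.bracket_tmul, one_mul]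
  let b := Module.finBasis K 𝔤
  let S : Finset (Module.Basis.ofVectorSpaceIndex K ℝ) :=
    Finset.univ.biUnion fun i => (φ (e (1 ⊗ₜ b i))).support
  have hS : ∀ i, e (1 ⊗ₜ b i) = ∑ j ∈ S, B j ⊗ₜ F j (b i) := by
    intro i
    conv_lhs => rw [← φ.symm_apply_apply (e (1 ⊗ₜ b i))]
    rw [TensorProduct.equivFinsuppOfBasisLeft_symm_apply]
    rw [Finsupp.sum_of_support_subset (s := S)]
    · rfl
    · intro j hj
      exact Finset.mem_biUnion.2 ⟨i, Finset.mem_univ _, hj⟩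
    · simp
  have hsum : e = ∑ j ∈ S, B j • (F j).baseChange ℝ := by
    apply (b.baseChange ℝ).ext
    intro i
    rw [Module.Basis.baseChange_apply, hS]
    simp [LinearMap.sum_apply, TensorProduct.smul_tmul']
  refine ⟨S.card, fun i => B (S.equivFin.symm i), fun i => F (S.equivFin.symm i),
    fun i => hFc _, ?_⟩
  rw [hsum, ← Finset.sum_coe_sort S]
  exact (Equiv.sum_comp S.equivFin.symm
    (fun j : S => B (j : _) • (F (j : _)).baseChange ℝ)).symm

theorem trace_ineq_real (K : Type*) [Field K] [Algebra K ℝ]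
    (hK : Set.range (algebraMap K ℝ) = {x : ℝ | IsAlgebraic ℚ x})
    (𝔤 : Type*) [LieRing 𝔤] [LieAlgebra K 𝔤] [Module.Finite K 𝔤]
    (h : IsIndecomposableLieAlgebra K 𝔤)
    (e : Module.End ℝ (ℝ ⊗[K] 𝔤)) (he : CentroidLike ℝ (ℝ ⊗[K] 𝔤) e) :
    (Module.finrank K 𝔤 : ℝ) * LinearMap.trace ℝ _ (e * e) ≤ (LinearMap.trace ℝ _ e) ^ 2 := by
  obtain ⟨m, β, E, hE, rfl⟩ := exists_expansion K 𝔤 e he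
  have hdense : DenseRange (algebraMap K ℝ) := by
    have : CharZero K := (algebraMap K ℝ).charZero
    refine Dense.mono ?_ Rat.denseRange_cast
    rintro _ ⟨q, rfl⟩
    exact ⟨(q : K), map_ratCast _ q⟩
  have hd : DenseRange (Pi.map (fun _ : Fin m => (algebraMap K ℝ : K → ℝ))) :=
    DenseRange.piMap (fun _ => hdense)
  have e1 : ∀ t : Fin m → ℝ, LinearMap.trace ℝ _ (∑ i, t i • (E i).baseChange ℝ) =
      ∑ i, t i * algebraMap K ℝ (LinearMap.trace K 𝔤 (E i)) := by
    intro t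
    simp [map_sum, LinearMap.trace_baseChange]
  have e2 : ∀ t : Fin m → ℝ, LinearMap.trace ℝ _ ((∑ i, t i • (E i).baseChange ℝ) *
      (∑ i, t i • (E i).baseChange ℝ)) =
      ∑ i, ∑ j, t i * (t j * algebraMap K ℝ (LinearMap.trace K 𝔤 (E i * E j))) := by
    intro t
    rw [Finset.sum_mul_sum]
    simp only [map_sum, smul_mul_assoc, mul_smul_comm, map_smul, smul_eq_mul,
      ← LinearMap.baseChange_mul, LinearMap.trace_baseChange]
    exact Finset.sum_congr rfl fun i _ => Finset.sum_congr rfl fun j _ => by ring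
  rw [e1, e2]
  refine hd.induction_on (p := fun t : Fin m → ℝ => (Module.finrank K 𝔤 : ℝ) *
    (∑ i, ∑ j, t i * (t j * algebraMap K ℝ (LinearMap.trace K 𝔤 (E i * E j)))) ≤
    (∑ i, t i * algebraMap K ℝ (LinearMap.trace K 𝔤 (E i))) ^ 2) β ?_ ?_
  · exact isClosed_le (by fun_prop) (by fun_prop)
  · intro t
    have hmem : CentroidLike K 𝔤 (∑ i, t i • E i) :=
      Subalgebra.sum_mem (centroidSub K 𝔤) (fun i _ => Subalgebra.smul_mem _ (hE i) _)
    have := trace_ineq K hK 𝔤 h _ hmem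
    rw [Finset.sum_mul_sum] at this
    simp only [map_sum, smul_mul_assoc, mul_smul_comm, map_smul, smul_eq_mul, map_mul] at this
    have e3 : ∀ i j, algebraMap K ℝ (t j) * (algebraMap K ℝ (t i) *
        algebraMap K ℝ (LinearMap.trace K 𝔤 (E i * E j))) = algebraMap K ℝ (t i) *
        (algebraMap K ℝ (t j) * algebraMap K ℝ (LinearMap.trace K 𝔤 (E i * E j))) :=
      fun i j => by ring
    simp only [e3] at this
    exact this

/-- Let `K` be the field of real algebraic numbers `ℝ ∩ ℚ̄` (a field
mapped into `ℝ` whose image is exactly the set of reals algebraic over `ℚ`) and `𝔤` a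
finite-dimensional `K`-Lie algebra. Then the real Lie algebra `ℝ ⊗[K] 𝔤` obtained by
extension of scalars is indecomposable if and only if `𝔤` is indecomposable. -/
theorem baseChange_indecomposable_iff
    (K : Type*) [Field K] [Algebra K ℝ]
    (hK : Set.range (algebraMap K ℝ) = {x : ℝ | IsAlgebraic ℚ x})
    (𝔤 : Type*) [LieRing 𝔤] [LieAlgebra K 𝔤] [Module.Finite K 𝔤] :
    IsIndecomposableLieAlgebra ℝ (ℝ ⊗[K] 𝔤) ↔ IsIndecomposableLieAlgebra K 𝔤 := by
  constructor
  · intro h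
    refine ⟨?_, ?_⟩
    · by_contra hn
      rw [not_nontrivial_iff_subsingleton] at hn
      have := h.1
      exact not_subsingleton (ℝ ⊗[K] 𝔤) inferInstance
    · intro I J h1 h2
      obtain ⟨e, hc, hi, hI, hJ⟩ := exists_centroid_idem I J h1 h2
      have hi' : IsIdempotentElem (e.baseChange ℝ) := by
        rw [IsIdempotentElem, ← LinearMap.baseChange_mul, hi]
      rcases indec_idem h _ (centroid_baseChange e hc) hi' with h3 | h3
      · exact Or.inl (hI (baseChange_inj e h3))
      · right
        apply hJ
        have : (e - 1).baseChange ℝ = 0 := by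
          rw [LinearMap.baseChange_sub, h3, LinearMap.baseChange_one, sub_self]
        exact sub_eq_zero.1 (baseChange_inj _ this)
  · intro h
    have := h.1
    refine ⟨(Module.FaithfullyFlat.tensorProduct_mk_injective
      (A := K) (B := ℝ) 𝔤).nontrivial, ?_⟩
    intro I J h1 h2
    obtain ⟨e, hc, hi, hI, hJ⟩ := exists_centroid_idem I J h1 h2
    have hineq := trace_ineq_real K hK 𝔤 h e hc
    have hp := LinearMap.IsIdempotentElem.isProj_range _ hi
    rw [hi, hp.trace] at hineq
    have hle : Module.finrank ℝ (LinearMap.range e) ≤ Module.finrank K 𝔤 := by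
      rw [← Module.finrank_baseChange (R := ℝ) (S := K) (M' := 𝔤)]
      exact Submodule.finrank_le _
    rcases Nat.eq_zero_or_pos (Module.finrank ℝ (LinearMap.range e)) with h0 | h0
    · left
      apply hI
      exact LinearMap.range_eq_bot.1 (Submodule.finrank_eq_zero.1 h0)
    · right
      apply hJ
      have h4 : Module.finrank K 𝔤 * Module.finrank ℝ (LinearMap.range e) ≤
        Module.finrank ℝ (LinearMap.range e) ^ 2 := by exact_mod_cast hineq
      rw [pow_two] at h4
      have h5 := Nat.le_of_mul_le_mul_right h4 h0
      have h6 : LinearMap.range e = ⊤ := by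
        apply Submodule.eq_top_of_finrank_eq
        rw [Module.finrank_baseChange]
        exact le_antisymm hle h5
      refine LinearMap.ext fun x => ?_
      exact hp.map_id x (h6 ▸ Submodule.mem_top)
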